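/- arXiv:1006.5207 — 2 statements merged into one kernel-verified Lean document; each statement's English description precedes it below -/
import Mathlib

section
/- Let p₁, q₁, p₂, q₂ be the generic real polynomials of degrees n₁, m₁, n₂, m₂ respectively (coefficients independent indeterminates, with K the fraction field of the coefficient ring), and let M_fdb ∈ K[s]^{3×4} be the matrix with rows (0, 1, 1, −1), (p₁, −q₁, 0, 0), (q₂, 0, −p₂, 0) describing the feedback interconnection of two SISO systems with transfer functions q₁/p₁ and q₂/p₂. Then (a) every position (i,j) with nonzero entry of M_fdb belongs to some R-saturating matching of the support of M_fdb (no edge of the associated bipartite graph is redundant), and (b) the 3 × 3 minors of M_fdb generate the unit ideal of K[s], i.e., the feedback interconnection is structurally controllable. -/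
/-- The coefficient field `K`: the field of fractions of the multivariate
polynomial ring over `ℝ` whose indeterminates are the coefficients of the four
generic polynomials `p₁` (degree `n₁`), `q₁` (degree `m₁`), `p₂` (degree `n₂`),
`q₂` (degree `m₂`). -/
abbrev Kc (n₁ m₁ n₂ m₂ : ℕ) :=
  FractionRing
    (MvPolynomial (Fin (n₁ + 1) ⊕ Fin (m₁ + 1) ⊕ Fin (n₂ + 1) ⊕ Fin (m₂ + 1)) ℝ)

/-- The image in `K` of the coefficient indeterminate indexed by `x`. -/
noncomputable def coeffVar (n₁ m₁ n₂ m₂ : ℕ)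
    (x : Fin (n₁ + 1) ⊕ Fin (m₁ + 1) ⊕ Fin (n₂ + 1) ⊕ Fin (m₂ + 1)) :
    Kc n₁ m₁ n₂ m₂ :=
  algebraMap
    (MvPolynomial (Fin (n₁ + 1) ⊕ Fin (m₁ + 1) ⊕ Fin (n₂ + 1) ⊕ Fin (m₂ + 1)) ℝ)
    (Kc n₁ m₁ n₂ m₂) (MvPolynomial.X x)

/-- The generic polynomial `p₁ = ∑_{ℓ ≤ n₁} a_ℓ s^ℓ`. -/
noncomputable def P1 (n₁ m₁ n₂ m₂ : ℕ) : Polynomial (Kc n₁ m₁ n₂ m₂) :=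
  ∑ ℓ : Fin (n₁ + 1),
    Polynomial.C (coeffVar n₁ m₁ n₂ m₂ (Sum.inl ℓ)) * Polynomial.X ^ (ℓ : ℕ)

/-- The generic polynomial `q₁ = ∑_{ℓ ≤ m₁} b_ℓ s^ℓ`. -/
noncomputable def Q1 (n₁ m₁ n₂ m₂ : ℕ) : Polynomial (Kc n₁ m₁ n₂ m₂) :=
  ∑ ℓ : Fin (m₁ + 1),
    Polynomial.C (coeffVar n₁ m₁ n₂ m₂ (Sum.inr (Sum.inl ℓ))) * Polynomial.X ^ (ℓ : ℕ)

/-- The generic polynomial `p₂ = ∑_{ℓ ≤ n₂} c_ℓ s^ℓ`. -/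
noncomputable def P2 (n₁ m₁ n₂ m₂ : ℕ) : Polynomial (Kc n₁ m₁ n₂ m₂) :=
  ∑ ℓ : Fin (n₂ + 1),
    Polynomial.C (coeffVar n₁ m₁ n₂ m₂ (Sum.inr (Sum.inr (Sum.inl ℓ)))) *
      Polynomial.X ^ (ℓ : ℕ)

/-- The generic polynomial `q₂ = ∑_{ℓ ≤ m₂} e_ℓ s^ℓ`. -/
noncomputable def Q2 (n₁ m₁ n₂ m₂ : ℕ) : Polynomial (Kc n₁ m₁ n₂ m₂) :=
  ∑ ℓ : Fin (m₂ + 1),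
    Polynomial.C (coeffVar n₁ m₁ n₂ m₂ (Sum.inr (Sum.inr (Sum.inr ℓ)))) *
      Polynomial.X ^ (ℓ : ℕ)


/-- The kernel-representation matrix of the feedback interconnection of two
SISO systems with transfer functions `q₁/p₁` and `q₂/p₂`:
rows `(0, 1, 1, −1)`, `(p₁, −q₁, 0, 0)`, `(q₂, 0, −p₂, 0)`. -/
noncomputable def Mfdb (n₁ m₁ n₂ m₂ : ℕ) :
    Matrix (Fin 3) (Fin 4) (Polynomial (Kc n₁ m₁ n₂ m₂)) :=
  !![0, 1, 1, -1;
     P1 n₁ m₁ n₂ m₂, -Q1 n₁ m₁ n₂ m₂, 0, 0;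
     Q2 n₁ m₁ n₂ m₂, 0, -P2 n₁ m₁ n₂ m₂, 0]

/-- The polynomial of degree at most `n` whose coefficients are the indeterminates `u 0, …, u n`. -/
noncomputable def genericPoly {σ : Type*} {n : ℕ} (u : Fin (n + 1) → σ) :
    Polynomial (MvPolynomial σ ℝ) :=
  ∑ ℓ : Fin (n + 1), Polynomial.C (MvPolynomial.X (u ℓ)) * Polynomial.X ^ (ℓ : ℕ)

lemma natDegree_genericPoly_le {σ : Type*} {n : ℕ} (u : Fin (n + 1) → σ) :
    (genericPoly u).natDegree ≤ n :=
  Polynomial.natDegree_sum_le_of_forall_le _ _ fun ℓ _ =>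
    (Polynomial.natDegree_C_mul_X_pow_le _ _).trans (Nat.lt_succ_iff.mp ℓ.isLt)

lemma map_genericPoly {σ S : Type*} [CommRing S] {n : ℕ} (u : Fin (n + 1) → σ)
    (φ : MvPolynomial σ ℝ →+* S) :
    (genericPoly u).map φ = ∑ ℓ : Fin (n + 1),
      Polynomial.C (φ (MvPolynomial.X (u ℓ))) * Polynomial.X ^ (ℓ : ℕ) := by
  simp [genericPoly, Polynomial.map_sum]

/-- A ring homomorphism sending exactly one coefficient `u k` to `1` and the others to `0`
sends the generic polynomial to the monomial `X ^ k`. -/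
lemma map_genericPoly_eq_X_pow {σ S : Type*} [CommRing S] {n : ℕ} (u : Fin (n + 1) → σ)
    (φ : MvPolynomial σ ℝ →+* S) (k : Fin (n + 1))
    (hφ : ∀ ℓ, φ (MvPolynomial.X (u ℓ)) = if ℓ = k then 1 else 0) :
    (genericPoly u).map φ = Polynomial.X ^ (k : ℕ) := by
  rw [map_genericPoly, Finset.sum_eq_single k]
  · simp [hφ]
  · intro ℓ _ hℓ
    simp [hφ, hℓ]
  · simp

lemma map_genericPoly_ne_zero {σ K : Type*} [Field K] [Algebra (MvPolynomial σ ℝ) K]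
    [FaithfulSMul (MvPolynomial σ ℝ) K] {n : ℕ} (u : Fin (n + 1) → σ)
    (hu : Function.Injective u) :
    (genericPoly u).map (algebraMap (MvPolynomial σ ℝ) K) ≠ 0 := by
  classical
  rw [Ne, Polynomial.map_eq_zero_iff (FaithfulSMul.algebraMap_injective _ _)]
  intro h
  have h1 := map_genericPoly_eq_X_pow u
    (MvPolynomial.eval fun x => if x = u 0 then (1 : ℝ) else 0) 0 (by simp [hu.eq_iff])
  simp [h] at h1

lemma resultant_genericPoly_ne_zero {σ : Type*} {n m : ℕ} (u : Fin (n + 1) → σ)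
    (v : Fin (m + 1) → σ) (hu : Function.Injective u) (hv : Function.Injective v)
    (huv : ∀ i j, u i ≠ v j) :
    (genericPoly u).resultant (genericPoly v) n m ≠ 0 := by
  classical
  intro h
  set φ : MvPolynomial σ ℝ →+* ℝ :=
    MvPolynomial.eval fun x => if x = u 0 ∨ x = v (Fin.last m) then (1 : ℝ) else 0 with hφ
  have h1 : (genericPoly u).map φ = 1 := by
    simpa using map_genericPoly_eq_X_pow u φ 0 (by simp [hφ, hu.eq_iff, huv])
  have h2 : (genericPoly v).map φ = Polynomial.X ^ m := by
    simpa using map_genericPoly_eq_X_pow v φ (Fin.last m)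
      (by simp [hφ, hv.eq_iff, fun i j => (huv i j).symm])
  have h3 := Polynomial.resultant_map_map (genericPoly u) (genericPoly v) n m φ
  rw [h, h1, h2, map_zero, Polynomial.resultant_one_left] at h3
  simp at h3

/-- Two generic polynomials with independent coefficients are coprime. -/
lemma isCoprime_map_genericPoly {σ K : Type*} [Field K] [Algebra (MvPolynomial σ ℝ) K]
    [FaithfulSMul (MvPolynomial σ ℝ) K] {n m : ℕ} (u : Fin (n + 1) → σ)
    (v : Fin (m + 1) → σ) (hu : Function.Injective u) (hv : Function.Injective v)
    (huv : ∀ i j, u i ≠ v j) :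
    IsCoprime ((genericPoly u).map (algebraMap (MvPolynomial σ ℝ) K))
      ((genericPoly v).map (algebraMap (MvPolynomial σ ℝ) K)) := by
  rcases Nat.eq_zero_or_pos n with rfl | hn
  · refine isCoprime_one_left.of_isCoprime_of_dvd_left (isUnit_iff_dvd_one.mp ?_)
    have hne := map_genericPoly_ne_zero (K := K) u hu
    rw [Polynomial.isUnit_iff_degree_eq_zero, Polynomial.degree_eq_natDegree hne]
    have hdeg := (Polynomial.natDegree_map_le (f := algebraMap (MvPolynomial σ ℝ) K)).trans
      (natDegree_genericPoly_le u)
    exact_mod_cast Nat.le_zero.mp hdeg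
  · obtain ⟨a, b, -, -, hab⟩ := Polynomial.exists_mul_add_mul_eq_C_resultant
      (genericPoly u) (genericPoly v) (natDegree_genericPoly_le u) (natDegree_genericPoly_le v)
      (Or.inl hn.ne')
    set ψ := algebraMap (MvPolynomial σ ℝ) K
    set r := (genericPoly u).resultant (genericPoly v) n m
    have hr : ψ r ≠ 0 := (map_ne_zero_iff ψ (FaithfulSMul.algebraMap_injective _ _)).mpr
      (resultant_genericPoly_ne_zero u v hu hv huv)
    have hab' := congrArg (Polynomial.map ψ) hab
    simp only [Polynomial.map_add, Polynomial.map_mul, Polynomial.map_C] at hab'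
    refine ⟨Polynomial.C (ψ r)⁻¹ * a.map ψ, Polynomial.C (ψ r)⁻¹ * b.map ψ, ?_⟩
    calc _ = Polynomial.C (ψ r)⁻¹ * ((genericPoly u).map ψ * a.map ψ +
          (genericPoly v).map ψ * b.map ψ) := by ring
      _ = 1 := by rw [hab', ← Polynomial.C_mul, inv_mul_cancel₀ hr, Polynomial.C_1]

/-- The index type of the coefficient indeterminates of the four generic polynomials. -/
abbrev CoeffIndex (n₁ m₁ n₂ m₂ : ℕ) :=
  Fin (n₁ + 1) ⊕ Fin (m₁ + 1) ⊕ Fin (n₂ + 1) ⊕ Fin (m₂ + 1)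

lemma P1_eq_map_genericPoly (n₁ m₁ n₂ m₂ : ℕ) :
    P1 n₁ m₁ n₂ m₂ =
      (genericPoly Sum.inl).map
        (algebraMap (MvPolynomial (CoeffIndex n₁ m₁ n₂ m₂) ℝ) (Kc n₁ m₁ n₂ m₂)) :=
  (map_genericPoly _ _).symm

lemma Q1_eq_map_genericPoly (n₁ m₁ n₂ m₂ : ℕ) :
    Q1 n₁ m₁ n₂ m₂ =
      (genericPoly fun ℓ => Sum.inr (Sum.inl ℓ)).map
        (algebraMap (MvPolynomial (CoeffIndex n₁ m₁ n₂ m₂) ℝ) (Kc n₁ m₁ n₂ m₂)) :=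
  (map_genericPoly _ _).symm

lemma P2_eq_map_genericPoly (n₁ m₁ n₂ m₂ : ℕ) :
    P2 n₁ m₁ n₂ m₂ =
      (genericPoly fun ℓ => Sum.inr (Sum.inr (Sum.inl ℓ))).map
        (algebraMap (MvPolynomial (CoeffIndex n₁ m₁ n₂ m₂) ℝ) (Kc n₁ m₁ n₂ m₂)) :=
  (map_genericPoly _ _).symm

lemma Q2_eq_map_genericPoly (n₁ m₁ n₂ m₂ : ℕ) :
    Q2 n₁ m₁ n₂ m₂ =
      (genericPoly fun ℓ => Sum.inr (Sum.inr (Sum.inr ℓ))).map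
        (algebraMap (MvPolynomial (CoeffIndex n₁ m₁ n₂ m₂) ℝ) (Kc n₁ m₁ n₂ m₂)) :=
  (map_genericPoly _ _).symm

lemma Ideal.IsPrime.not_mem_of_isCoprime {R : Type*} [CommRing R] {I : Ideal R} (hI : I.IsPrime)
    {x y : R} (h : IsCoprime x y) (hx : x ∈ I) : y ∉ I := by
  intro hy
  obtain ⟨a, b, hab⟩ := h
  exact hI.ne_top ((Ideal.eq_top_iff_one _).mpr
    (hab ▸ I.add_mem (I.mul_mem_left a hx) (I.mul_mem_left b hy)))

/-- If the consecutive pairs of `p₁, q₁, p₂, q₂` are coprime, then `p₁ p₂`, `q₁ p₂` and `q₁ q₂`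
have no common prime divisor, so an ideal containing them is the unit ideal. -/
lemma Ideal.eq_top_of_isCoprime_chain {R : Type*} [CommRing R] {I : Ideal R} {p₁ q₁ p₂ q₂ : R}
    (h₁ : IsCoprime p₁ q₁) (h₂ : IsCoprime q₁ p₂) (h₃ : IsCoprime p₂ q₂)
    (hp : p₁ * p₂ ∈ I) (hqp : q₁ * p₂ ∈ I) (hq : q₁ * q₂ ∈ I) : I = ⊤ := by
  by_contra hI
  obtain ⟨J, hJ, hIJ⟩ := Ideal.exists_le_maximal I hI
  have hJp := hJ.isPrime
  rcases hJp.mem_or_mem (hIJ hqp) with h | h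
  · rcases hJp.mem_or_mem (hIJ hp) with h' | h'
    · exact hJp.not_mem_of_isCoprime h₁ h' h
    · exact hJp.not_mem_of_isCoprime h₂ h h'
  · rcases hJp.mem_or_mem (hIJ hq) with h' | h'
    · exact hJp.not_mem_of_isCoprime h₂ h' h
    · exact hJp.not_mem_of_isCoprime h₃ h h'

/-- The feedback interconnection: (a) no edge of the bipartite graph of
`M_fdb` is redundant (every nonzero position lies in some `R`-saturating
matching of the support), and (b) the `3 × 3` minors of `M_fdb` generate the
unit ideal of `K[s]`, i.e. the feedback interconnection is structurally
controllable. -/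
theorem feedback_interconnection_no_redundant_and_controllable (n₁ m₁ n₂ m₂ : ℕ) :
    (∀ (i : Fin 3) (j : Fin 4), Mfdb n₁ m₁ n₂ m₂ i j ≠ 0 →
      ∃ f : Fin 3 → Fin 4, Function.Injective f ∧
        (∀ k, Mfdb n₁ m₁ n₂ m₂ k (f k) ≠ 0) ∧ f i = j) ∧
    Ideal.span {q : Polynomial (Kc n₁ m₁ n₂ m₂) | ∃ c : Fin 3 → Fin 4,
        Function.Injective c ∧
        q = ((Mfdb n₁ m₁ n₂ m₂).submatrix id c).det} = ⊤ := by
  have hp₁ : P1 n₁ m₁ n₂ m₂ ≠ 0 := by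
    rw [P1_eq_map_genericPoly]
    exact map_genericPoly_ne_zero _ Sum.inl_injective
  have hq₁ : Q1 n₁ m₁ n₂ m₂ ≠ 0 := by
    rw [Q1_eq_map_genericPoly]
    exact map_genericPoly_ne_zero _ fun a b h => by simpa using h
  have hp₂ : P2 n₁ m₁ n₂ m₂ ≠ 0 := by
    rw [P2_eq_map_genericPoly]
    exact map_genericPoly_ne_zero _ fun a b h => by simpa using h
  have hq₂ : Q2 n₁ m₁ n₂ m₂ ≠ 0 := by
    rw [Q2_eq_map_genericPoly]
    exact map_genericPoly_ne_zero _ fun a b h => by simpa using h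
  have h₁ : IsCoprime (P1 n₁ m₁ n₂ m₂) (Q1 n₁ m₁ n₂ m₂) := by
    rw [P1_eq_map_genericPoly, Q1_eq_map_genericPoly]
    exact isCoprime_map_genericPoly _ _ Sum.inl_injective
      (fun a b h => by simpa using h) (by simp)
  have h₂ : IsCoprime (Q1 n₁ m₁ n₂ m₂) (P2 n₁ m₁ n₂ m₂) := by
    rw [Q1_eq_map_genericPoly, P2_eq_map_genericPoly]
    exact isCoprime_map_genericPoly _ _ (fun a b h => by simpa using h)
      (fun a b h => by simpa using h) (by simp)
  have h₃ : IsCoprime (P2 n₁ m₁ n₂ m₂) (Q2 n₁ m₁ n₂ m₂) := by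
    rw [P2_eq_map_genericPoly, Q2_eq_map_genericPoly]
    exact isCoprime_map_genericPoly _ _ (fun a b h => by simpa using h)
      (fun a b h => by simpa using h) (by simp)
  constructor
  · have m₁₀₂ : ∀ k, Mfdb n₁ m₁ n₂ m₂ k (![1, 0, 2] k) ≠ 0 := by
      intro k; fin_cases k <;> simp [Mfdb, hp₁, hp₂]
    have m₂₁₀ : ∀ k, Mfdb n₁ m₁ n₂ m₂ k (![2, 1, 0] k) ≠ 0 := by
      intro k; fin_cases k <;> simp [Mfdb, hq₁, hq₂]
    have m₃₁₂ : ∀ k, Mfdb n₁ m₁ n₂ m₂ k (![3, 1, 2] k) ≠ 0 := by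
      intro k; fin_cases k <;> simp [Mfdb, hq₁, hp₂]
    intro i j hij
    have hcover : ![1, 0, 2] i = j ∨ ![2, 1, 0] i = j ∨ ![3, 1, 2] i = j := by
      fin_cases i <;> fin_cases j <;> simp [Mfdb] at hij ⊢
    rcases hcover with h | h | h
    · exact ⟨![1, 0, 2], by decide, m₁₀₂, h⟩
    · exact ⟨![2, 1, 0], by decide, m₂₁₀, h⟩
    · exact ⟨![3, 1, 2], by decide, m₃₁₂, h⟩
  · refine Ideal.eq_top_of_isCoprime_chain h₁ h₂ h₃ (Ideal.subset_span ⟨![0, 2, 3], by decide, ?_⟩)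
      (Ideal.subset_span ⟨![2, 1, 3], by decide, ?_⟩)
      (Ideal.subset_span ⟨![1, 0, 3], by decide, ?_⟩) <;>
    · simp only [Matrix.det_fin_three, Mfdb, Matrix.submatrix_apply, id, Matrix.of_apply,
        Matrix.cons_val]
      ring
end

section
/- Let M be the generic p × v polynomial matrix associated to a degree pattern d with support S, possibly without any R-saturating matching (a non-minimal description). Let r₁ ≥ 1 be the maximum size of a matching in S, i.e., the largest t for which there are t positions in S with pairwise distinct rows and pairwise distinct columns. Call an edge (i,j) ∈ S redundant when it belongs to no matching of S of size r₁, and let G_nr be the graph on Fin p ⊕ Fin v in which row vertex i and column vertex j are adjacent exactly when (i,j) ∈ S is non-redundant. Then the r₁ × r₁ minors of M generate the unit ideal of K[s] (i.e., the system is structurally controllable: M(λ) has rank r₁ for every λ in any extension field) if and only if for every connected component g of G_nr in which the number of row vertices equals the number of column vertices, every non-redundant edge (i,j) with both endpoints in g has d(i,j) = some 0. -/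
/-- The generic polynomial matrix associated to a degree pattern
`d : Fin p × Fin v → Option ℕ`: the `(i,j)` entry is `0` when `d (i,j) = none`,
and is the generic degree-`k` polynomial `∑_{ℓ=0}^{k} X_{(i,j),ℓ} s^ℓ`
(with independent indeterminate coefficients, viewed in the fraction field `K`
of the multivariate polynomial ring over `ℝ`) when `d (i,j) = some k`. -/
noncomputable def genericMatrix {p v : ℕ} (d : Fin p × Fin v → Option ℕ) :
    Matrix (Fin p) (Fin v)
      (Polynomial (FractionRing (MvPolynomial ((Fin p × Fin v) × ℕ) ℝ))) :=
  fun i j =>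
    match d (i, j) with
    | none => 0
    | some k => ∑ ℓ ∈ Finset.range (k + 1),
        Polynomial.C (algebraMap (MvPolynomial ((Fin p × Fin v) × ℕ) ℝ)
            (FractionRing (MvPolynomial ((Fin p × Fin v) × ℕ) ℝ))
            (MvPolynomial.X ((i, j), ℓ))) * Polynomial.X ^ ℓ

/-- A matching of the support of `d`: a finite set of positions of the support
with pairwise distinct rows and pairwise distinct columns. -/
def IsMatching {p v : ℕ} (d : Fin p × Fin v → Option ℕ)
    (T : Finset (Fin p × Fin v)) : Prop :=
  (∀ e ∈ T, d e ≠ none) ∧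
    ∀ e ∈ T, ∀ e' ∈ T, e ≠ e' → e.1 ≠ e'.1 ∧ e.2 ≠ e'.2

/-- An edge `(i, j)` of the support is non-redundant (relative to the maximum
matching size `r₁`) when it belongs to some matching of size `r₁`. -/
def NonRedundantNM {p v : ℕ} (d : Fin p × Fin v → Option ℕ) (r₁ : ℕ)
    (i : Fin p) (j : Fin v) : Prop :=
  ∃ T : Finset (Fin p × Fin v), IsMatching d T ∧ T.card = r₁ ∧ (i, j) ∈ T

/-- The graph `G_nr` on `Fin p ⊕ Fin v` in which a row vertex `i` and a column
vertex `j` are adjacent exactly when `(i, j)` is a non-redundant edge. -/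
def GnrNM {p v : ℕ} (d : Fin p × Fin v → Option ℕ) (r₁ : ℕ) :
    SimpleGraph (Fin p ⊕ Fin v) :=
  SimpleGraph.fromRel fun a b =>
    ∃ i j, NonRedundantNM d r₁ i j ∧ a = Sum.inl i ∧ b = Sum.inr j

theorem IsMatching.eq_of_fst {p v : ℕ} {d : Fin p × Fin v → Option ℕ}
    {T : Finset (Fin p × Fin v)} (hT : IsMatching d T) {e e' : Fin p × Fin v}
    (he : e ∈ T) (he' : e' ∈ T) (h : e.1 = e'.1) : e = e' := by
  by_contra hne
  exact (hT.2 e he e' he' hne).1 h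

theorem IsMatching.eq_of_snd {p v : ℕ} {d : Fin p × Fin v → Option ℕ}
    {T : Finset (Fin p × Fin v)} (hT : IsMatching d T) {e e' : Fin p × Fin v}
    (he : e ∈ T) (he' : e' ∈ T) (h : e.2 = e'.2) : e = e' := by
  by_contra hne
  exact (hT.2 e he e' he' hne).2 h

theorem IsMatching.subset {p v : ℕ} {d : Fin p × Fin v → Option ℕ}
    {T T' : Finset (Fin p × Fin v)} (hT : IsMatching d T) (h : T' ⊆ T) : IsMatching d T' :=
  ⟨fun e he => hT.1 e (h he), fun e he e' he' => hT.2 e (h he) e' (h he')⟩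

/-- Adding an edge whose endpoints are both unmatched yields a matching. -/
theorem IsMatching.insert {p v : ℕ} {d : Fin p × Fin v → Option ℕ}
    {T : Finset (Fin p × Fin v)} (hT : IsMatching d T) {i : Fin p} {j : Fin v}
    (hd : d (i, j) ≠ none) (hi : ∀ e ∈ T, e.1 ≠ i) (hj : ∀ e ∈ T, e.2 ≠ j) :
    IsMatching d (insert (i, j) T) := by
  refine ⟨fun e he => ?_, fun e he e' he' hne => ?_⟩
  · rcases Finset.mem_insert.1 he with rfl | he
    · exact hd
    · exact hT.1 e he
  · rcases Finset.mem_insert.1 he with rfl | he <;> rcases Finset.mem_insert.1 he' with rfl | he'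
    · exact absurd rfl hne
    · exact ⟨(hi e' he').symm, (hj e' he').symm⟩
    · exact ⟨hi e he, hj e he⟩
    · exact hT.2 e he e' he' hne

/-- `T` is a matching of maximum size `r`. -/
def MaxMatching {p v : ℕ} (d : Fin p × Fin v → Option ℕ) (r : ℕ)
    (T : Finset (Fin p × Fin v)) : Prop :=
  IsMatching d T ∧ T.card = r ∧ ∀ T', IsMatching d T' → T'.card ≤ r

/-- A column is missable when some maximum matching leaves it unmatched. -/
def ColMissable {p v : ℕ} (d : Fin p × Fin v → Option ℕ) (r : ℕ) (j : Fin v) : Prop :=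
  ∃ T, MaxMatching d r T ∧ ∀ e ∈ T, e.2 ≠ j

/-- A row is missable when some maximum matching leaves it unmatched. -/
def RowMissable {p v : ℕ} (d : Fin p × Fin v → Option ℕ) (r : ℕ) (i : Fin p) : Prop :=
  ∃ T, MaxMatching d r T ∧ ∀ e ∈ T, e.1 ≠ i

/-- A set of columns containing those missed by `T` and closed under `T`-alternating paths, all
of whose members are missable. -/
theorem MaxMatching.exists_alternating_closed {p v : ℕ} {d : Fin p × Fin v → Option ℕ} {r : ℕ}
    {T : Finset (Fin p × Fin v)} (hT : MaxMatching d r T) :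
    ∃ Z : Finset (Fin v), (∀ j, (∀ e ∈ T, e.2 ≠ j) → j ∈ Z) ∧ (∀ j ∈ Z, ColMissable d r j) ∧
      ∀ i, ∀ j ∈ Z, d (i, j) ≠ none → ∃ j' ∈ Z, (i, j') ∈ T := by
  classical
  let Q : Finset (Fin v) → Prop := fun Z => (∀ j, (∀ e ∈ T, e.2 ≠ j) → j ∈ Z) ∧
    ∀ j ∈ Z, ∃ T', MaxMatching d r T' ∧ (∀ e ∈ T', e.2 ≠ j) ∧
      (∀ e ∈ T, e.2 ∉ Z → e ∈ T') ∧ ∀ i, (∃ e ∈ T', e.1 = i) → ∃ e ∈ T, e.1 = i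
  have hQ : ∃ Z, Q Z := by
    refine ⟨Finset.univ.filter fun j => ∀ e ∈ T, e.2 ≠ j, fun j hj => by simpa using hj,
      fun j hj => ⟨T, hT, by simpa using hj, fun e he _ => he, fun i h => h⟩⟩
  obtain ⟨Z, hZ⟩ := Set.Finite.exists_maximal (s := {Z | Q Z}) (Set.toFinite _) hQ
  have hZQ : Q Z := hZ.1
  refine ⟨Z, hZQ.1, fun j hj => ?_, fun i j hj hd => ?_⟩
  · obtain ⟨T', h1, h2, -⟩ := hZQ.2 j hj
    exact ⟨T', h1, h2⟩
  obtain ⟨T', h1, h2, h3, h4⟩ := hZQ.2 j hj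
  have hi : ∃ e ∈ T', e.1 = i := by
    by_contra! hi
    have := h1.2.2 _ (h1.1.insert hd hi h2)
    rw [Finset.card_insert_of_notMem (fun h => hi _ h rfl), h1.2.1] at this
    omega
  obtain ⟨⟨i', j'⟩, he, rfl⟩ := h4 i hi
  refine ⟨j', ?_, he⟩
  by_contra hj'
  have he' : (i', j') ∈ T' := h3 _ he hj'
  have hswap : IsMatching d (insert (i', j) (T'.erase (i', j'))) := by
    refine (h1.1.subset (Finset.erase_subset _ _)).insert hd (fun e h hh => ?_)
      (fun e h => h2 e (Finset.mem_of_mem_erase h))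
    exact (Finset.ne_of_mem_erase h) (h1.1.eq_of_fst (Finset.mem_of_mem_erase h) he' hh)
  have hjj : j ≠ j' := fun h => hj' (h ▸ hj)
  have hnew : Q (insert j' Z) := by
    refine ⟨fun k hk => Finset.mem_insert_of_mem (hZQ.1 k hk), fun k hk => ?_⟩
    rcases Finset.mem_insert.1 hk with rfl | hk
    · refine ⟨_, ⟨hswap, ?_, h1.2.2⟩, fun e h hh => ?_, fun e h hh => ?_, fun i hi => ?_⟩
      · rw [Finset.card_insert_of_notMem (fun h => h2 _ (Finset.mem_of_mem_erase h) rfl),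
          Finset.card_erase_add_one he', h1.2.1]
      · rcases Finset.mem_insert.1 h with rfl | h
        · exact hjj hh
        · exact Finset.ne_of_mem_erase h
            (h1.1.eq_of_snd (Finset.mem_of_mem_erase h) he' hh)
      · rw [Finset.mem_insert, not_or] at hh
        refine Finset.mem_insert_of_mem (Finset.mem_erase.2 ⟨fun h' => hh.1 (by rw [h']), ?_⟩)
        exact h3 e h hh.2
      · obtain ⟨e, h, rfl⟩ := hi
        rcases Finset.mem_insert.1 h with rfl | h
        · exact ⟨_, he, rfl⟩
        · exact h4 _ ⟨e, Finset.mem_of_mem_erase h, rfl⟩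
    · obtain ⟨T₂, g1, g2, g3, g4⟩ := hZQ.2 k hk
      exact ⟨T₂, g1, g2, fun e h hh => g3 e h fun h' => hh (Finset.mem_insert_of_mem h'), g4⟩
  exact hj' (hZ.2 hnew (Finset.subset_insert _ _) (Finset.mem_insert_self _ _))

/-- Every maximum matching matches a neighbour of a missable column, to a missable column. -/
theorem ColMissable.exists_mem {p v : ℕ} {d : Fin p × Fin v → Option ℕ} {r : ℕ}
    {i : Fin p} {j : Fin v} (hj : ColMissable d r j) (hd : d (i, j) ≠ none)
    {T : Finset (Fin p × Fin v)} (hT : MaxMatching d r T) :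
    ∃ j', (i, j') ∈ T ∧ ColMissable d r j' := by
  classical
  obtain ⟨T₀, hT₀, hj₀⟩ := hj
  obtain ⟨Z, hZ1, hZ2, hZ3⟩ := hT₀.exists_alternating_closed
  let W : Finset (Fin p) := Finset.univ.filter fun i => ∃ j ∈ Z, d (i, j) ≠ none
  have hW : ∀ i, i ∈ W ↔ ∃ j ∈ Z, d (i, j) ≠ none := fun i => by simp [W]
  have hi : i ∈ W := (hW i).2 ⟨j, hZ1 j hj₀, hd⟩
  have inj (U : Finset (Fin p × Fin v)) (hU : MaxMatching d r U) :
      Set.InjOn Prod.fst (↑(U.filter fun e => e.2 ∈ Z) : Set (Fin p × Fin v)) :=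
    fun e he e' he' h => hU.1.eq_of_fst (Finset.mem_filter.1 he).1 (Finset.mem_filter.1 he').1 h
  have sub (U : Finset (Fin p × Fin v)) (hU : MaxMatching d r U) :
      (U.filter fun e => e.2 ∈ Z).image Prod.fst ⊆ W := by
    intro a ha
    obtain ⟨e, he, rfl⟩ := Finset.mem_image.1 ha
    rw [Finset.mem_filter] at he
    exact (hW _).2 ⟨e.2, he.2, hU.1.1 _ he.1⟩
  have h0 : W.card ≤ (T₀.filter fun e => e.2 ∈ Z).card := by
    rw [← Finset.card_image_of_injOn (inj T₀ hT₀)]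
    refine Finset.card_le_card fun a ha => ?_
    obtain ⟨b, hb, hab⟩ := (hW a).1 ha
    obtain ⟨b', hb', hab'⟩ := hZ3 a b hb hab
    exact Finset.mem_image.2 ⟨(a, b'), Finset.mem_filter.2 ⟨hab', hb'⟩, rfl⟩
  have h1 : Zᶜ.card ≤ (T₀.filter fun e => ¬ e.2 ∈ Z).card := by
    refine (Finset.card_le_card ?_).trans (Finset.card_image_le (f := Prod.snd))
    intro b hb
    rw [Finset.mem_compl] at hb
    have : ¬ ∀ e ∈ T₀, e.2 ≠ b := fun h => hb (hZ1 b h)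
    push Not at this
    obtain ⟨e, he, rfl⟩ := this
    exact Finset.mem_image.2 ⟨e, Finset.mem_filter.2 ⟨he, hb⟩, rfl⟩
  have h2 : (T.filter fun e => ¬ e.2 ∈ Z).card ≤ Zᶜ.card := by
    rw [← Finset.card_image_of_injOn (f := Prod.snd) (s := T.filter fun e => ¬ e.2 ∈ Z)
      (fun e he e' he' h =>
        hT.1.eq_of_snd (Finset.mem_filter.1 he).1 (Finset.mem_filter.1 he').1 h)]
    refine Finset.card_le_card fun b hb => ?_
    obtain ⟨e, he, rfl⟩ := Finset.mem_image.1 hb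
    simpa using (Finset.mem_filter.1 he).2
  have c0 := T₀.card_filter_add_card_filter_not (fun e => e.2 ∈ Z)
  have c1 := T.card_filter_add_card_filter_not (fun e => e.2 ∈ Z)
  have r0 := hT₀.2.1
  have r1 := hT.2.1
  have heq : (T.filter fun e => e.2 ∈ Z).image Prod.fst = W := by
    refine Finset.eq_of_subset_of_card_le (sub T hT) ?_
    rw [Finset.card_image_of_injOn (inj T hT)]
    omega
  rw [← heq] at hi
  obtain ⟨⟨a, b⟩, he, rfl⟩ := Finset.mem_image.1 hi
  rw [Finset.mem_filter] at he
  exact ⟨b, he.1, hZ2 b he.2⟩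

theorem MaxMatching.swap {p v : ℕ} {d : Fin p × Fin v → Option ℕ} {r : ℕ}
    {T : Finset (Fin p × Fin v)} (hT : MaxMatching d r T) :
    MaxMatching (d ∘ Prod.swap) r (T.map (Equiv.prodComm _ _).toEmbedding) := by
  have aux {p v : ℕ} {d : Fin p × Fin v → Option ℕ} {T : Finset (Fin p × Fin v)}
      (hT : IsMatching d T) :
      IsMatching (d ∘ Prod.swap) (T.map (Equiv.prodComm _ _).toEmbedding) := by
    refine ⟨fun e he => ?_, fun e he e' he' hne => ?_⟩
    · obtain ⟨f, hf, rfl⟩ := Finset.mem_map.1 he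
      exact hT.1 f hf
    · obtain ⟨f, hf, rfl⟩ := Finset.mem_map.1 he
      obtain ⟨f', hf', rfl⟩ := Finset.mem_map.1 he'
      exact (hT.2 f hf f' hf' fun h => hne (by rw [h])).symm
  refine ⟨aux hT.1, by rw [Finset.card_map, hT.2.1], fun T' hT' => ?_⟩
  have := hT.2.2 _ (aux hT')
  rwa [Finset.card_map] at this

theorem RowMissable.swap {p v : ℕ} {d : Fin p × Fin v → Option ℕ} {r : ℕ} {i : Fin p}
    (hi : RowMissable d r i) : ColMissable (d ∘ Prod.swap) r i := by
  obtain ⟨T, hT, h⟩ := hi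
  refine ⟨_, hT.swap, fun e he => ?_⟩
  obtain ⟨f, hf, rfl⟩ := Finset.mem_map.1 he
  exact h f hf

theorem ColMissable.swap {p v : ℕ} {d : Fin p × Fin v → Option ℕ} {r : ℕ} {j : Fin v}
    (hj : ColMissable d r j) : RowMissable (d ∘ Prod.swap) r j := by
  obtain ⟨T, hT, h⟩ := hj
  refine ⟨_, hT.swap, fun e he => ?_⟩
  obtain ⟨f, hf, rfl⟩ := Finset.mem_map.1 he
  exact h f hf

/-- Every maximum matching matches a neighbour of a missable row, to a missable row. -/
theorem RowMissable.exists_mem {p v : ℕ} {d : Fin p × Fin v → Option ℕ} {r : ℕ}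
    {i : Fin p} {j : Fin v} (hi : RowMissable d r i) (hd : d (i, j) ≠ none)
    {T : Finset (Fin p × Fin v)} (hT : MaxMatching d r T) :
    ∃ i', (i', j) ∈ T ∧ RowMissable d r i' := by
  obtain ⟨i', h, hi'⟩ := hi.swap.exists_mem (i := j) hd hT.swap
  obtain ⟨⟨a, b⟩, hf, hab⟩ := Finset.mem_map.1 h
  simp only [Equiv.coe_toEmbedding, Equiv.prodComm_apply, Prod.swap_prod_mk,
    Prod.mk.injEq] at hab
  obtain ⟨rfl, rfl⟩ := hab
  exact ⟨a, hf, hi'.swap⟩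

/-- A predicate invariant along non-redundant edges is constant on components of `GnrNM`. -/
theorem GnrNM_component_induction {p v : ℕ} {d : Fin p × Fin v → Option ℕ} {r : ℕ}
    {A : Fin p ⊕ Fin v → Prop}
    (hA : ∀ i j, NonRedundantNM d r i j → (A (Sum.inl i) ↔ A (Sum.inr j)))
    {x y : Fin p ⊕ Fin v}
    (hxy : (GnrNM d r).connectedComponentMk x = (GnrNM d r).connectedComponentMk y)
    (hx : A x) : A y := by
  obtain ⟨w⟩ := SimpleGraph.ConnectedComponent.eq.1 hxy
  induction w with
  | nil => exact hx
  | @cons a b c hab w ih =>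
    refine ih (SimpleGraph.ConnectedComponent.eq.2 ⟨w⟩) ?_
    rw [GnrNM, SimpleGraph.fromRel_adj] at hab
    rcases hab.2 with ⟨i, j, h, rfl, rfl⟩ | ⟨i, j, h, rfl, rfl⟩
    · exact (hA i j h).1 hx
    · exact (hA i j h).2 hx

theorem NonRedundantNM.ne_none {p v : ℕ} {d : Fin p × Fin v → Option ℕ} {r : ℕ}
    {i : Fin p} {j : Fin v} (h : NonRedundantNM d r i j) : d (i, j) ≠ none := by
  obtain ⟨T, hT, -, hij⟩ := h
  exact hT.1 _ hij

/-- The endpoints of a non-redundant edge lie in the same component. -/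
theorem NonRedundantNM.component_eq {p v : ℕ} {d : Fin p × Fin v → Option ℕ} {r : ℕ}
    {i : Fin p} {j : Fin v} (h : NonRedundantNM d r i j) :
    (GnrNM d r).connectedComponentMk (Sum.inl i) =
      (GnrNM d r).connectedComponentMk (Sum.inr j) := by
  refine SimpleGraph.ConnectedComponent.eq.2 (SimpleGraph.Adj.reachable ?_)
  rw [GnrNM, SimpleGraph.fromRel_adj]
  exact ⟨by simp, Or.inl ⟨i, j, h, rfl, rfl⟩⟩

/-- Missability of columns propagates through components. -/
theorem ColMissable.of_component_eq {p v : ℕ} {d : Fin p × Fin v → Option ℕ} {r : ℕ}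
    (hub : ∀ T', IsMatching d T' → T'.card ≤ r) {j j' : Fin v} (hj : ColMissable d r j)
    (hjj : (GnrNM d r).connectedComponentMk (Sum.inr j) =
      (GnrNM d r).connectedComponentMk (Sum.inr j')) : ColMissable d r j' := by
  refine GnrNM_component_induction (A := Sum.elim
    (fun i => ∃ j, NonRedundantNM d r i j ∧ ColMissable d r j) (ColMissable d r)) ?_ hjj hj
  intro i k hik
  refine ⟨fun h => ?_, fun h => ⟨k, hik, h⟩⟩
  obtain ⟨l, hil, hl⟩ := h
  obtain ⟨T, hT, hr, hikT⟩ := hik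
  obtain ⟨k', hk', hm⟩ := hl.exists_mem hil.ne_none ⟨hT, hr, hub⟩
  have := hT.eq_of_fst hk' hikT rfl
  simp only [Prod.mk.injEq, true_and] at this
  exact this ▸ hm

/-- Missability of rows propagates through components. -/
theorem RowMissable.of_component_eq {p v : ℕ} {d : Fin p × Fin v → Option ℕ} {r : ℕ}
    (hub : ∀ T', IsMatching d T' → T'.card ≤ r) {i i' : Fin p} (hi : RowMissable d r i)
    (hii : (GnrNM d r).connectedComponentMk (Sum.inl i) =
      (GnrNM d r).connectedComponentMk (Sum.inl i')) : RowMissable d r i' := by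
  refine GnrNM_component_induction (A := Sum.elim (RowMissable d r)
    (fun j => ∃ i, NonRedundantNM d r i j ∧ RowMissable d r i)) ?_ hii hi
  intro k j hkj
  refine ⟨fun h => ⟨k, hkj, h⟩, fun h => ?_⟩
  obtain ⟨l, hlj, hl⟩ := h
  obtain ⟨T, hT, hr, hkjT⟩ := hkj
  obtain ⟨k', hk', hm⟩ := hl.exists_mem hlj.ne_none ⟨hT, hr, hub⟩
  have := hT.eq_of_snd hk' hkjT rfl
  simp only [Prod.mk.injEq, and_true] at this
  exact this ▸ hm

/-- The edges of a maximum matching are non-redundant. -/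
theorem MaxMatching.nonRedundant {p v : ℕ} {d : Fin p × Fin v → Option ℕ} {r : ℕ}
    {T : Finset (Fin p × Fin v)} (hT : MaxMatching d r T) {i : Fin p} {j : Fin v}
    (h : (i, j) ∈ T) : NonRedundantNM d r i j :=
  ⟨T, hT.1, hT.2.1, h⟩

/-- A component all of whose rows are matched by `T` embeds its rows into its columns. -/
theorem MaxMatching.exists_row_map {p v : ℕ} {d : Fin p × Fin v → Option ℕ} {r : ℕ}
    {T : Finset (Fin p × Fin v)} (hT : MaxMatching d r T)
    {g : (GnrNM d r).ConnectedComponent}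
    (hg : ∀ i, (GnrNM d r).connectedComponentMk (Sum.inl i) = g → ∃ e ∈ T, e.1 = i) :
    ∃ f : {i : Fin p // (GnrNM d r).connectedComponentMk (Sum.inl i) = g} →
        {j : Fin v // (GnrNM d r).connectedComponentMk (Sum.inr j) = g},
      Function.Injective f ∧ ∀ i, (i.1, (f i).1) ∈ T := by
  have : ∀ i : {i : Fin p // (GnrNM d r).connectedComponentMk (Sum.inl i) = g},
      ∃ j : {j : Fin v // (GnrNM d r).connectedComponentMk (Sum.inr j) = g}, (i.1, j.1) ∈ T := by
    rintro ⟨i, hi⟩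
    obtain ⟨⟨a, b⟩, he, rfl⟩ := hg i hi
    exact ⟨⟨b, (hT.nonRedundant he).component_eq.symm.trans hi⟩, he⟩
  choose f hf using this
  refine ⟨f, fun a b hab => ?_, hf⟩
  have := hT.1.eq_of_snd (hf a) (hf b) (by rw [hab])
  exact Subtype.ext (congrArg Prod.fst this)

/-- A component all of whose columns are matched by `T` embeds its columns into its rows. -/
theorem MaxMatching.exists_col_map {p v : ℕ} {d : Fin p × Fin v → Option ℕ} {r : ℕ}
    {T : Finset (Fin p × Fin v)} (hT : MaxMatching d r T)
    {g : (GnrNM d r).ConnectedComponent}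
    (hg : ∀ j, (GnrNM d r).connectedComponentMk (Sum.inr j) = g → ∃ e ∈ T, e.2 = j) :
    ∃ f : {j : Fin v // (GnrNM d r).connectedComponentMk (Sum.inr j) = g} →
        {i : Fin p // (GnrNM d r).connectedComponentMk (Sum.inl i) = g},
      Function.Injective f ∧ ∀ j, ((f j).1, j.1) ∈ T := by
  have : ∀ j : {j : Fin v // (GnrNM d r).connectedComponentMk (Sum.inr j) = g},
      ∃ i : {i : Fin p // (GnrNM d r).connectedComponentMk (Sum.inl i) = g}, (i.1, j.1) ∈ T := by
    rintro ⟨j, hj⟩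
    obtain ⟨⟨a, b⟩, he, rfl⟩ := hg j hj
    exact ⟨⟨a, (hT.nonRedundant he).component_eq.trans hj⟩, he⟩
  choose f hf using this
  refine ⟨f, fun a b hab => ?_, hf⟩
  have := hT.1.eq_of_fst (hf a) (hf b) (by rw [hab])
  exact Subtype.ext (congrArg Prod.snd this)

/-- The rows of a balanced component are matched by every maximum matching. -/
theorem MaxMatching.exists_mem_of_card_eq {p v : ℕ} {d : Fin p × Fin v → Option ℕ} {r : ℕ}
    {T : Finset (Fin p × Fin v)} (hT : MaxMatching d r T)
    {g : (GnrNM d r).ConnectedComponent}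
    (hcard : Nat.card {i : Fin p // (GnrNM d r).connectedComponentMk (Sum.inl i) = g} =
      Nat.card {j : Fin v // (GnrNM d r).connectedComponentMk (Sum.inr j) = g})
    {i : Fin p} (hi : (GnrNM d r).connectedComponentMk (Sum.inl i) = g) : ∃ e ∈ T, e.1 = i := by
  by_contra! hmiss
  have hRi : RowMissable d r i := ⟨T, hT, hmiss⟩
  obtain ⟨f, hf, hfT⟩ := hT.exists_col_map (g := g) (by
    intro j hj
    -- every column of the component has a neighbour
    have hex : ∃ i', NonRedundantNM d r i' j := by
      by_contra! hno
      have := GnrNM_component_induction (d := d) (r := r) (A := fun x => x = Sum.inr j)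
        (fun a b hab => ⟨fun h => by simp at h, fun h => by
          rw [Sum.inr.injEq] at h
          exact absurd (h ▸ hab) (hno a)⟩) (hj.trans hi.symm) rfl
      simp at this
    obtain ⟨i', hi'⟩ := hex
    obtain ⟨k, hk, -⟩ := (hRi.of_component_eq hT.2.2 (hi.trans
      (hj.symm.trans hi'.component_eq.symm))).exists_mem hi'.ne_none hT
    exact ⟨_, hk, rfl⟩)
  have hbij := (Nat.bijective_iff_injective_and_card f).2 ⟨hf, hcard.symm⟩
  obtain ⟨j, hj⟩ := hbij.2 ⟨i, hi⟩
  exact hmiss _ (hfT j) (by rw [hj])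

/-- An endpoint of an edge of an unbalanced component is missable. -/
theorem NonRedundantNM.missable_of_card_ne {p v : ℕ} {d : Fin p × Fin v → Option ℕ} {r : ℕ}
    (hub : ∀ T', IsMatching d T' → T'.card ≤ r) {i : Fin p} {j : Fin v}
    (hij : NonRedundantNM d r i j) {g : (GnrNM d r).ConnectedComponent}
    (hi : (GnrNM d r).connectedComponentMk (Sum.inl i) = g)
    (hcard : Nat.card {i : Fin p // (GnrNM d r).connectedComponentMk (Sum.inl i) = g} ≠
      Nat.card {j : Fin v // (GnrNM d r).connectedComponentMk (Sum.inr j) = g}) :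
    RowMissable d r i ∨ ColMissable d r j := by
  by_contra! hno
  obtain ⟨T, hT, hr, -⟩ := id hij
  have hM : MaxMatching d r T := ⟨hT, hr, hub⟩
  obtain ⟨f, hf, -⟩ := hM.exists_row_map (g := g) (by
    intro i' hi'
    by_contra! h
    exact hno.1 (RowMissable.of_component_eq hub ⟨T, hM, h⟩ (hi'.trans hi.symm)))
  obtain ⟨f₂, hf₂, -⟩ := hM.exists_col_map (g := g) (by
    intro j' hj'
    by_contra! h
    exact hno.2 (ColMissable.of_component_eq hub ⟨T, hM, h⟩
      (hj'.trans (hi.symm.trans hij.component_eq))))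
  exact hcard (le_antisymm (Nat.card_le_card_of_injective f hf)
    (Nat.card_le_card_of_injective f₂ hf₂))

/-- The matrix with degree pattern `d` whose coefficients are given by `x`, evaluated at `s`. -/
def patternMatrix {p v : ℕ} (d : Fin p × Fin v → Option ℕ) {A : Type*} [CommRing A]
    (x : (Fin p × Fin v) × ℕ → A) (s : A) : Matrix (Fin p) (Fin v) A :=
  fun i j =>
    match d (i, j) with
    | none => 0
    | some k => ∑ ℓ ∈ Finset.range (k + 1), x ((i, j), ℓ) * s ^ ℓ

section patternMatrix

variable {p v : ℕ} {d : Fin p × Fin v → Option ℕ} {A B : Type*} [CommRing A] [CommRing B]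

theorem patternMatrix_of_none {x : (Fin p × Fin v) × ℕ → A} {s : A} {i : Fin p} {j : Fin v}
    (h : d (i, j) = none) : patternMatrix d x s i j = 0 := by
  simp [patternMatrix, h]

theorem patternMatrix_of_some {x : (Fin p × Fin v) × ℕ → A} {s : A} {i : Fin p} {j : Fin v}
    {k : ℕ} (h : d (i, j) = some k) :
    patternMatrix d x s i j = ∑ ℓ ∈ Finset.range (k + 1), x ((i, j), ℓ) * s ^ ℓ := by
  simp [patternMatrix, h]

theorem map_patternMatrix_apply (f : A →+* B) (x : (Fin p × Fin v) × ℕ → A) (s : A)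
    (i : Fin p) (j : Fin v) :
    f (patternMatrix d x s i j) = patternMatrix d (f ∘ x) (f s) i j := by
  rcases h : d (i, j) with _ | k
  · rw [patternMatrix_of_none h, patternMatrix_of_none h, map_zero]
  · rw [patternMatrix_of_some h, patternMatrix_of_some h]
    simp

theorem map_det_patternMatrix {n : Type*} [Fintype n] [DecidableEq n] (f : A →+* B)
    (x : (Fin p × Fin v) × ℕ → A) (s : A) (rsel : n → Fin p) (csel : n → Fin v) :
    f ((patternMatrix d x s).submatrix rsel csel).det =
      ((patternMatrix d (f ∘ x) (f s)).submatrix rsel csel).det := by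
  rw [RingHom.map_det]
  congr 1
  ext a b
  exact map_patternMatrix_apply f x s _ _

theorem genericMatrix_eq_patternMatrix (d : Fin p × Fin v → Option ℕ) :
    genericMatrix d = patternMatrix d
      (fun q => Polynomial.C (algebraMap (MvPolynomial ((Fin p × Fin v) × ℕ) ℝ)
        (FractionRing (MvPolynomial ((Fin p × Fin v) × ℕ) ℝ)) (MvPolynomial.X q)))
      Polynomial.X := by
  ext1 i j
  rfl

theorem patternMatrix_mem {R : Type*} [CommRing R] [Algebra R A] (S : Subalgebra R A)
    {x : (Fin p × Fin v) × ℕ → A} {s : A} {i : Fin p} {j : Fin v}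
    (h : ∀ k, d (i, j) = some k → ∀ ℓ ≤ k, x ((i, j), ℓ) * s ^ ℓ ∈ S) :
    patternMatrix d x s i j ∈ S := by
  rcases hk : d (i, j) with _ | k
  · rw [patternMatrix_of_none hk]
    exact S.zero_mem
  · rw [patternMatrix_of_some hk]
    exact sum_mem fun ℓ hℓ => h k hk ℓ (Nat.lt_succ_iff.1 (Finset.mem_range.1 hℓ))

theorem Matrix.det_mem_subalgebra {n R : Type*} [Fintype n] [DecidableEq n] [CommRing R]
    [Algebra R A] (S : Subalgebra R A) {M : Matrix n n A} (h : ∀ a b, M a b ∈ S) : M.det ∈ S := by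
  rw [Matrix.det_apply']
  exact sum_mem fun τ _ => mul_mem (intCast_mem S _) (prod_mem fun a _ => h _ _)

/-- Specializing the coefficients to single powers of `s` on a set `T` of positions. -/
theorem patternMatrix_indicator {T : Finset (Fin p × Fin v)} {m : Fin p × Fin v → ℕ}
    (hT : ∀ e ∈ T, ∃ k, d e = some k ∧ m e ≤ k) (s : A) (i : Fin p) (j : Fin v) :
    patternMatrix d (fun q => if q.1 ∈ T ∧ q.2 = m q.1 then 1 else 0) s i j =
      if (i, j) ∈ T then s ^ m (i, j) else 0 := by
  split_ifs with h
  · obtain ⟨k, hk, hm⟩ := hT _ h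
    rw [patternMatrix_of_some hk]
    simp [h, hm]
  · rcases hk : d (i, j) with _ | k
    · exact patternMatrix_of_none hk
    · rw [patternMatrix_of_some hk]
      simp [h]

/-- A matching of size `r` specializes the corresponding minor to `1`. -/
theorem det_patternMatrix_indicator {r : ℕ} {T : Finset (Fin p × Fin v)} (hT : IsMatching d T)
    {rsel : Fin r → Fin p} {csel : Fin r → Fin v} (hr : Function.Injective rsel)
    (hsel : ∀ k, (rsel k, csel k) ∈ T) (s : A) :
    ((patternMatrix d (fun q => if q.1 ∈ T ∧ q.2 = 0 then 1 else 0) s).submatrix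
      rsel csel).det = 1 := by
  refine Eq.trans (congrArg Matrix.det ?_) Matrix.det_one
  ext a b
  rw [Matrix.submatrix_apply, patternMatrix_indicator (m := fun _ => 0)
    (fun e he => (Option.ne_none_iff_exists'.1 (hT.1 e he)).imp fun k hk => ⟨hk, Nat.zero_le _⟩),
    Matrix.one_apply, pow_zero]
  refine if_congr ⟨fun h => ?_, fun h => h ▸ hsel a⟩ rfl rfl
  exact hr (congrArg Prod.fst (hT.eq_of_snd h (hsel b) rfl))

end patternMatrix

/-- A matching of size `r` is enumerated by `Fin r`. -/
theorem IsMatching.exists_enumeration {p v : ℕ} {d : Fin p × Fin v → Option ℕ} {r : ℕ}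
    {T : Finset (Fin p × Fin v)} (hT : IsMatching d T) (hr : T.card = r) :
    ∃ (rsel : Fin r → Fin p) (csel : Fin r → Fin v), Function.Injective rsel ∧
      Function.Injective csel ∧ ∀ k, (rsel k, csel k) ∈ T := by
  let e := (T.equivFinOfCardEq hr).symm
  refine ⟨fun k => (e k).1.1, fun k => (e k).1.2, fun a b h => ?_, fun a b h => ?_,
    fun k => (e k).2⟩
  · exact e.injective (Subtype.ext (hT.eq_of_fst (e a).2 (e b).2 h))
  · exact e.injective (Subtype.ext (hT.eq_of_snd (e a).2 (e b).2 h))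

/-- A permutation whose term in a minor avoids the structural zeros yields a matching. -/
theorem exists_matching_of_perm {p v : ℕ} {d : Fin p × Fin v → Option ℕ} {r : ℕ}
    {rsel : Fin r → Fin p} {csel : Fin r → Fin v} (hr : Function.Injective rsel)
    (hc : Function.Injective csel) {τ : Equiv.Perm (Fin r)}
    (h : ∀ k, d (rsel (τ k), csel k) ≠ none) :
    ∃ T, IsMatching d T ∧ T.card = r ∧ (∀ k, (rsel (τ k), csel k) ∈ T) ∧
      ∀ e ∈ T, ∃ k, rsel k = e.1 := by
  classical
  refine ⟨Finset.univ.image fun k => (rsel (τ k), csel k), ⟨fun e he => ?_, ?_⟩, ?_, fun k => ?_,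
    fun e he => ?_⟩
  · obtain ⟨k, -, rfl⟩ := Finset.mem_image.1 he
    exact h k
  · intro e he e' he' hne
    obtain ⟨k, -, rfl⟩ := Finset.mem_image.1 he
    obtain ⟨k', -, rfl⟩ := Finset.mem_image.1 he'
    have hk : k ≠ k' := fun h => hne (by rw [h])
    exact ⟨fun h => hk (τ.injective (hr h)), fun h => hk (hc h)⟩
  · rw [Finset.card_image_of_injective _ fun a b hab => hc (congrArg Prod.snd hab),
      Finset.card_univ, Fintype.card_fin]
  · exact Finset.mem_image_of_mem _ (Finset.mem_univ k)
  · obtain ⟨k, -, rfl⟩ := Finset.mem_image.1 he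
    exact ⟨_, rfl⟩

open Classical in
/-- The degree pattern obtained by replacing redundant edges by structural zeros. -/
noncomputable def nonRedundantPattern {p v : ℕ} (d : Fin p × Fin v → Option ℕ) (r : ℕ) :
    Fin p × Fin v → Option ℕ :=
  fun e => if NonRedundantNM d r e.1 e.2 then d e else none

theorem nonRedundantPattern_of_nonRedundant {p v : ℕ} {d : Fin p × Fin v → Option ℕ} {r : ℕ}
    {i : Fin p} {j : Fin v} (h : NonRedundantNM d r i j) :
    nonRedundantPattern d r (i, j) = d (i, j) :=
  if_pos h

theorem nonRedundantPattern_of_redundant {p v : ℕ} {d : Fin p × Fin v → Option ℕ} {r : ℕ}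
    {i : Fin p} {j : Fin v} (h : ¬ NonRedundantNM d r i j) :
    nonRedundantPattern d r (i, j) = none :=
  if_neg h

/-- Redundant edges do not contribute to the minors of maximum size. -/
theorem det_nonRedundantPattern {p v : ℕ} (d : Fin p × Fin v → Option ℕ) {r : ℕ}
    {A : Type*} [CommRing A] (x : (Fin p × Fin v) × ℕ → A) (s : A)
    {rsel : Fin r → Fin p} {csel : Fin r → Fin v} (hr : Function.Injective rsel)
    (hc : Function.Injective csel) :
    ((patternMatrix (nonRedundantPattern d r) x s).submatrix rsel csel).det =
      ((patternMatrix d x s).submatrix rsel csel).det := by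
  rw [Matrix.det_apply', Matrix.det_apply']
  refine Finset.sum_congr rfl fun τ _ => congrArg _ ?_
  simp only [Matrix.submatrix_apply]
  by_cases h : ∀ k, d (rsel (τ k), csel k) ≠ none
  · obtain ⟨T, hT, hcard, hmem, -⟩ := exists_matching_of_perm hr hc h
    refine Finset.prod_congr rfl fun k _ => ?_
    simp only [patternMatrix, nonRedundantPattern_of_nonRedundant ⟨T, hT, hcard, hmem k⟩]
  · push Not at h
    obtain ⟨k, hk⟩ := h
    rw [Finset.prod_eq_zero (Finset.mem_univ k), Finset.prod_eq_zero (Finset.mem_univ k)]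
    · exact patternMatrix_of_none hk
    · refine patternMatrix_of_none ?_
      by_cases hn : NonRedundantNM d r (rsel (τ k)) (csel k)
      · rw [nonRedundantPattern_of_nonRedundant hn, hk]
      · exact nonRedundantPattern_of_redundant hn

/-- If the block of a balanced component is singular, so are all minors of maximum size. -/
theorem det_eq_zero_of_block_det_eq_zero {p v : ℕ} {d : Fin p × Fin v → Option ℕ} {r : ℕ}
    (hub : ∀ T', IsMatching d T' → T'.card ≤ r) {F : Type*} [Field F]
    (x : (Fin p × Fin v) × ℕ → F) (s : F) {g : (GnrNM d r).ConnectedComponent}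
    (hcard : Nat.card {i : Fin p // (GnrNM d r).connectedComponentMk (Sum.inl i) = g} =
      Nat.card {j : Fin v // (GnrNM d r).connectedComponentMk (Sum.inr j) = g})
    [DecidableEq {i : Fin p // (GnrNM d r).connectedComponentMk (Sum.inl i) = g}]
    [Fintype {i : Fin p // (GnrNM d r).connectedComponentMk (Sum.inl i) = g}]
    {f : {i : Fin p // (GnrNM d r).connectedComponentMk (Sum.inl i) = g} →
      {j : Fin v // (GnrNM d r).connectedComponentMk (Sum.inr j) = g}}
    (hf : Function.Surjective f)
    (hdet : ((patternMatrix (nonRedundantPattern d r) x s).submatrix Subtype.val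
      (Subtype.val ∘ f)).det = 0)
    {rsel : Fin r → Fin p} {csel : Fin r → Fin v} (hr : Function.Injective rsel)
    (hc : Function.Injective csel) :
    ((patternMatrix d x s).submatrix rsel csel).det = 0 := by
  classical
  by_cases hτ : ∃ τ : Equiv.Perm (Fin r), ∀ k, d (rsel (τ k), csel k) ≠ none
  swap
  · push Not at hτ
    rw [Matrix.det_apply']
    refine Finset.sum_eq_zero fun τ _ => ?_
    obtain ⟨k, hk⟩ := hτ τ
    rw [Finset.prod_eq_zero (Finset.mem_univ k), mul_zero]
    exact patternMatrix_of_none hk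
  obtain ⟨τ, hτ⟩ := hτ
  obtain ⟨T, hT, hTr, -, hrows⟩ := exists_matching_of_perm hr hc hτ
  have hM : MaxMatching d r T := ⟨hT, hTr, hub⟩
  have hrange : ∀ i, (GnrNM d r).connectedComponentMk (Sum.inl i) = g → i ∈ Set.range rsel := by
    intro i hi
    obtain ⟨e, he, rfl⟩ := hM.exists_mem_of_card_eq hcard hi
    exact hrows e he
  obtain ⟨w, hw, hw0⟩ := Matrix.exists_vecMul_eq_zero_iff.2 hdet
  let W : Fin p → F := fun i =>
    if h : (GnrNM d r).connectedComponentMk (Sum.inl i) = g then w ⟨i, h⟩ else 0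
  have hWin : ∀ a, W a.1 = w a := fun a => dif_pos a.2
  have hWout : ∀ i, (GnrNM d r).connectedComponentMk (Sum.inl i) ≠ g → W i = 0 :=
    fun i h => dif_neg h
  rw [← det_nonRedundantPattern d x s hr hc]
  refine Matrix.exists_vecMul_eq_zero_iff.1 ⟨W ∘ rsel, fun h => ?_, ?_⟩
  · obtain ⟨a, ha⟩ := Function.ne_iff.1 hw
    obtain ⟨k, hk⟩ := hrange a.1 a.2
    refine ha ?_
    rw [← hWin, ← hk]
    exact congrFun h k
  ext l
  simp only [Matrix.vecMul, dotProduct, Function.comp_apply, Matrix.submatrix_apply,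
    Pi.zero_apply]
  rw [Fintype.sum_of_injective rsel hr _
    (fun i => W i * patternMatrix (nonRedundantPattern d r) x s i (csel l))
    (fun i hi => by rw [hWout i fun h => hi (hrange i h), zero_mul]) fun k => rfl]
  by_cases hl : (GnrNM d r).connectedComponentMk (Sum.inr (csel l)) = g
  · obtain ⟨b, hb⟩ := hf ⟨csel l, hl⟩
    rw [← Fintype.sum_of_injective Subtype.val Subtype.val_injective
      (fun a => w a * patternMatrix (nonRedundantPattern d r) x s a.1 (f b).1) _
      (fun i hi => by
        rw [hWout i fun h => hi ⟨⟨i, h⟩, rfl⟩, zero_mul]) fun a => by rw [hWin, hb]]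
    exact congrFun hw0 b
  · refine Finset.sum_eq_zero fun i _ => ?_
    by_cases hi : (GnrNM d r).connectedComponentMk (Sum.inl i) = g
    · rw [patternMatrix_of_none, mul_zero]
      exact nonRedundantPattern_of_redundant fun h => hl (h.component_eq.symm.trans hi)
    · rw [hWout i hi, zero_mul]

theorem MvPolynomial.notMem_vars_of_dvd {σ : Type*} {a b : MvPolynomial σ ℝ} {n : σ} (h : a ∣ b)
    (hb : b ≠ 0) (hn : b ∈ MvPolynomial.supported ℝ ({n}ᶜ : Set σ)) : n ∉ a.vars := by
  obtain ⟨c, rfl⟩ := h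
  have hn' : n ∉ (a * c).vars := fun hv => MvPolynomial.mem_supported.1 hn hv rfl
  rw [MvPolynomial.mem_vars_iff_degreeOf_ne_zero, not_not,
    MvPolynomial.degreeOf_mul_eq (left_ne_zero_of_mul hb) (right_ne_zero_of_mul hb)] at hn'
  rw [MvPolynomial.mem_vars_iff_degreeOf_ne_zero, not_not]
  omega

/-- A nonzero polynomial over a fraction field is associated to a primitive one. -/
theorem Polynomial.exists_isPrimitive_associated {R K : Type*} [CommRing R] [IsDomain R]
    [NormalizedGCDMonoid R] [Field K] [Algebra R K] [IsFractionRing R K] {g : Polynomial K}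
    (hg : g ≠ 0) :
    ∃ q : Polynomial R, q.IsPrimitive ∧ Associated (q.map (algebraMap R K)) g := by
  obtain ⟨b, hb, h⟩ := IsLocalization.integerNormalization_spec (nonZeroDivisors R) g
  set N := IsLocalization.integerNormalization (nonZeroDivisors R) g
  have hb0 : algebraMap R K b ≠ 0 := by
    simpa using nonZeroDivisors.ne_zero hb
  have hN : N ≠ 0 := fun h0 => hg (IsFractionRing.integerNormalization_eq_zero_iff.1 h0)
  have hc : algebraMap R K N.content ≠ 0 := by
    simpa [Polynomial.content_eq_zero_iff] using hN
  refine ⟨N.primPart, N.isPrimitive_primPart, ?_⟩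
  have key : Polynomial.C (algebraMap R K N.content) * N.primPart.map (algebraMap R K) =
      Polynomial.C (algebraMap R K b) * g := by
    rw [← Polynomial.map_C, ← Polynomial.map_mul, ← N.eq_C_content_mul_primPart, h,
      Algebra.smul_def]
    rfl
  have u₁ := Polynomial.isUnit_C.2 hc.isUnit
  have u₂ := Polynomial.isUnit_C.2 hb0.isUnit
  exact (associated_unit_mul_left _ _ u₁).symm.trans
    ((Associated.of_eq key).trans (associated_unit_mul_left _ _ u₂))

open MvPolynomial in
/-- A common divisor of the minors of maximum size of the generic matrix does not involve `s`
when every non-redundant edge of positive degree has a missable endpoint. -/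
theorem degreeOf_none_eq_zero_of_dvd_minors {p v : ℕ} {d : Fin p × Fin v → Option ℕ} {r : ℕ}
    {T : Finset (Fin p × Fin v)} (hT : MaxMatching d r T)
    (hd : ∀ i j, NonRedundantNM d r i j →
      d (i, j) = some 0 ∨ RowMissable d r i ∨ ColMissable d r j)
    {a : MvPolynomial (Option ((Fin p × Fin v) × ℕ)) ℝ}
    (ha : ∀ (rsel : Fin r → Fin p) (csel : Fin r → Fin v), Function.Injective rsel →
      Function.Injective csel →
      a ∣ ((patternMatrix d (fun q => X (some q)) (X none)).submatrix rsel csel).det) :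
    a.degreeOf none = 0 := by
  -- every minor supported by a maximum matching is nonzero, even for constant entries
  have hne : ∀ {T : Finset (Fin p × Fin v)}, IsMatching d T → ∀ {rsel : Fin r → Fin p}
      {csel : Fin r → Fin v}, Function.Injective rsel → (∀ k, (rsel k, csel k) ∈ T) →
      ∀ {x : (Fin p × Fin v) × ℕ → MvPolynomial (Option ((Fin p × Fin v) × ℕ)) ℝ},
      (∀ q, q.2 = 0 → x q = X (some q)) → (∀ q, q.2 ≠ 0 → x q = 0 ∨ x q = X (some q)) →
      ((patternMatrix d x (X none)).submatrix rsel csel).det ≠ 0 := by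
    intro T hT rsel csel hr hsel x hx0 hx1 h0
    let ψ : MvPolynomial (Option ((Fin p × Fin v) × ℕ)) ℝ →+* ℝ :=
      eval (fun o => o.elim 1 fun q => if q.1 ∈ T ∧ q.2 = 0 then 1 else 0)
    have h1 := map_det_patternMatrix (d := d) ψ x (X none) rsel csel
    have h2 : ψ ∘ x = fun q => if q.1 ∈ T ∧ q.2 = 0 then 1 else 0 := by
      funext q
      by_cases hq : q.2 = 0
      · simp [ψ, hx0 q hq]
      · rcases hx1 q hq with h | h <;> simp [ψ, h, hq]
    rw [h2, det_patternMatrix_indicator hT hr hsel, h0, map_zero] at h1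
    exact zero_ne_one h1
  have step : ∀ i j ℓ, some ((i, j), ℓ + 1) ∉ a.vars := by
    intro i j ℓ
    obtain ⟨T', hT', h⟩ : ∃ T', MaxMatching d r T' ∧
        (¬ NonRedundantNM d r i j ∨ d (i, j) = some 0 ∨ (∀ e ∈ T', e.1 ≠ i) ∨
          ∀ e ∈ T', e.2 ≠ j) := by
      by_cases hn : NonRedundantNM d r i j
      · rcases hd i j hn with h | ⟨T', hT', h⟩ | ⟨T', hT', h⟩
        · exact ⟨T, hT, Or.inr (Or.inl h)⟩
        · exact ⟨T', hT', Or.inr (Or.inr (Or.inl h))⟩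
        · exact ⟨T', hT', Or.inr (Or.inr (Or.inr h))⟩
      · exact ⟨T, hT, Or.inl hn⟩
    obtain ⟨rsel, csel, hr, hc, hsel⟩ := hT'.1.exists_enumeration hT'.2.1
    have h0 := hne hT'.1 hr hsel (x := fun q => X (some q)) (fun _ _ => rfl) fun _ _ => Or.inr rfl
    refine notMem_vars_of_dvd (ha rsel csel hr hc) h0 ?_
    clear h0
    rw [← det_nonRedundantPattern d _ _ hr hc]
    refine Matrix.det_mem_subalgebra (supported ℝ _) fun k l => ?_
    rw [Matrix.submatrix_apply]
    refine patternMatrix_mem (supported ℝ _) fun m hm t ht => ?_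
    have hnone : (X none : MvPolynomial (Option ((Fin p × Fin v) × ℕ)) ℝ) ∈
        supported ℝ ({some ((i, j), ℓ + 1)}ᶜ : Set (Option ((Fin p × Fin v) × ℕ))) :=
      X_mem_supported.2 (by simp)
    refine mul_mem ?_ (pow_mem hnone t)
    rw [X_mem_supported]
    intro hq
    simp only [Set.mem_singleton_iff, Option.some.injEq, Prod.mk.injEq] at hq
    obtain ⟨⟨rfl, rfl⟩, rfl⟩ := hq
    rcases h with h | h | h | h
    · rw [nonRedundantPattern_of_redundant h] at hm
      cases hm
    · by_cases hn : NonRedundantNM d r (rsel k) (csel l)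
      · rw [nonRedundantPattern_of_nonRedundant hn, h] at hm
        cases hm
        omega
      · rw [nonRedundantPattern_of_redundant hn] at hm
        cases hm
    · exact h _ (hsel k) rfl
    · exact h _ (hsel l) rfl
  -- setting the non-constant coefficients to zero fixes `a` and makes the minors free of `s`
  let φ : MvPolynomial (Option ((Fin p × Fin v) × ℕ)) ℝ →+*
      MvPolynomial (Option ((Fin p × Fin v) × ℕ)) ℝ :=
    (aeval (fun o => o.elim (X none) fun q => if q.2 = 0 then X (some q) else 0) :
      MvPolynomial (Option ((Fin p × Fin v) × ℕ)) ℝ →ₐ[ℝ] _).toRingHom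
  have hφX : ∀ o, φ (X o) =
      o.elim (X none) fun q => if q.2 = 0 then X (some q) else 0 := fun o => by simp [φ]
  have hφ : φ a = a := by
    refine hom_congr_vars (f₂ := RingHom.id _) (by ext; simp [φ]) (fun o ho _ => ?_) rfl
    rw [hφX]
    rcases o with _ | ⟨⟨i, j⟩, _ | ℓ⟩
    · rfl
    · simp
    · exact absurd ho (step i j ℓ)
  obtain ⟨rsel, csel, hr, hc, hsel⟩ := hT.1.exists_enumeration hT.2.1
  have hdvd := map_dvd φ (ha rsel csel hr hc)
  rw [hφ, map_det_patternMatrix, hφX] at hdvd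
  have hx : (φ ∘ fun q => X (some q)) =
      fun q : (Fin p × Fin v) × ℕ => if q.2 = 0 then X (some q) else 0 := by
    funext q
    exact hφX _
  rw [hx] at hdvd
  by_contra hdeg
  refine notMem_vars_of_dvd hdvd (hne hT.1 hr hsel (fun q hq => if_pos hq)
    fun q hq => Or.inl (if_neg hq)) ?_ (mem_vars_iff_degreeOf_ne_zero.2 hdeg)
  refine Matrix.det_mem_subalgebra (supported ℝ _) fun k l => ?_
  rw [Matrix.submatrix_apply]
  refine patternMatrix_mem (supported ℝ _) fun m hm t ht => ?_
  by_cases ht0 : t = 0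
  · subst ht0
    simp only [if_true, pow_zero, mul_one]
    exact X_mem_supported.2 (by simp)
  · simp [ht0]

/-- The minors of maximum size generate the unit ideal when every edge of positive degree has a
missable endpoint. -/
theorem span_minors_eq_top {p v : ℕ} {d : Fin p × Fin v → Option ℕ} {r : ℕ}
    {T : Finset (Fin p × Fin v)} (hT : MaxMatching d r T)
    (hd : ∀ i j, NonRedundantNM d r i j →
      d (i, j) = some 0 ∨ RowMissable d r i ∨ ColMissable d r j) :
    Ideal.span {q : Polynomial (FractionRing (MvPolynomial ((Fin p × Fin v) × ℕ) ℝ)) |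
        ∃ (rsel : Fin r → Fin p) (csel : Fin r → Fin v),
          Function.Injective rsel ∧ Function.Injective csel ∧
          q = ((genericMatrix d).submatrix rsel csel).det} = ⊤ := by
  set I := Ideal.span {q : Polynomial (FractionRing (MvPolynomial ((Fin p × Fin v) × ℕ) ℝ)) |
        ∃ (rsel : Fin r → Fin p) (csel : Fin r → Fin v),
          Function.Injective rsel ∧ Function.Injective csel ∧
          q = ((genericMatrix d).submatrix rsel csel).det} with hI
  let : NormalizedGCDMonoid (MvPolynomial ((Fin p × Fin v) × ℕ) ℝ) :=
    Classical.arbitrary _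
  let ι := algebraMap (MvPolynomial ((Fin p × Fin v) × ℕ) ℝ)
    (FractionRing (MvPolynomial ((Fin p × Fin v) × ℕ) ℝ))
  let e := MvPolynomial.optionEquivLeft ℝ ((Fin p × Fin v) × ℕ)
  let x : (Fin p × Fin v) × ℕ → Polynomial (MvPolynomial ((Fin p × Fin v) × ℕ) ℝ) :=
    fun q => Polynomial.C (MvPolynomial.X q)
  have hmap : ∀ (rsel : Fin r → Fin p) (csel : Fin r → Fin v),
      Polynomial.map ι ((patternMatrix d x Polynomial.X).submatrix rsel csel).det =
        ((genericMatrix d).submatrix rsel csel).det := by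
    intro rsel csel
    rw [← Polynomial.coe_mapRingHom, map_det_patternMatrix, genericMatrix_eq_patternMatrix]
    have : (Polynomial.mapRingHom ι ∘ x) = fun q => Polynomial.C (ι (MvPolynomial.X q)) := by
      funext q
      simp [x]
    rw [this, Polynomial.coe_mapRingHom, Polynomial.map_X]
  have hg : Submodule.IsPrincipal.generator I ≠ 0 := by
    intro h0
    obtain ⟨rsel, csel, hr, hc, hsel⟩ := hT.1.exists_enumeration hT.2.1
    have hmem : ((genericMatrix d).submatrix rsel csel).det ∈ I :=
      Ideal.subset_span ⟨rsel, csel, hr, hc, rfl⟩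
    rw [Submodule.IsPrincipal.mem_iff_generator_dvd, h0, zero_dvd_iff, ← hmap,
      Polynomial.map_eq_zero_iff (IsFractionRing.injective _ _)] at hmem
    have h1 := map_det_patternMatrix (d := d) (Polynomial.mapRingHom (MvPolynomial.eval
      (fun q => if q.1 ∈ T ∧ q.2 = 0 then (1 : ℝ) else 0))) x Polynomial.X rsel csel
    have h2 : (Polynomial.mapRingHom (MvPolynomial.eval
        (fun q => if q.1 ∈ T ∧ q.2 = 0 then (1 : ℝ) else 0)) ∘ x) =
        fun q => if q.1 ∈ T ∧ q.2 = 0 then 1 else 0 := by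
      funext q
      by_cases h : q.1 ∈ T ∧ q.2 = 0 <;> simp [x, h]
    rw [hmem, h2, det_patternMatrix_indicator hT.1 hr hsel, map_zero] at h1
    exact zero_ne_one h1
  obtain ⟨π, hπ, hassoc⟩ := Polynomial.exists_isPrimitive_associated
    (R := MvPolynomial ((Fin p × Fin v) × ℕ) ℝ) hg
  have hdeg : (e.symm π).degreeOf none = 0 := by
    refine degreeOf_none_eq_zero_of_dvd_minors hT hd fun rsel csel hr hc => ?_
    have h1 : π ∣ ((patternMatrix d x Polynomial.X).submatrix rsel csel).det := by
      refine hπ.dvd_of_fraction_map_dvd_fraction_map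
        (K := FractionRing (MvPolynomial ((Fin p × Fin v) × ℕ) ℝ)) ?_
      rw [hmap]
      exact hassoc.dvd.trans ((Submodule.IsPrincipal.mem_iff_generator_dvd I).1
        (Ideal.subset_span ⟨rsel, csel, hr, hc, rfl⟩))
    have h2 := map_dvd e.symm.toRingEquiv.toRingHom h1
    rw [map_det_patternMatrix] at h2
    have h3 : (e.symm.toRingEquiv.toRingHom ∘ x) = fun q => MvPolynomial.X (some q) := by
      funext q
      simp [x, e]
    rw [h3] at h2
    simpa [e] using h2
  rw [← MvPolynomial.natDegree_optionEquivLeft] at hdeg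
  have hdeg' : π.natDegree = 0 := by simpa [e] using hdeg
  have hunit : IsUnit (Submodule.IsPrincipal.generator I) := by
    refine hassoc.isUnit ?_
    have hπ0 : π.map ι ≠ 0 := fun h => hg (hassoc.eq_zero_iff.1 h)
    rw [Polynomial.isUnit_iff_degree_eq_zero, Polynomial.degree_eq_natDegree hπ0,
      Polynomial.natDegree_map_eq_of_injective (IsFractionRing.injective _ _), hdeg']
    rfl
  exact Ideal.eq_top_of_isUnit_mem _ (Submodule.IsPrincipal.generator_mem I) hunit

/-- The minors of maximum size have a common zero when some balanced component has an edge of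
positive degree. -/
theorem span_minors_ne_top {p v : ℕ} {d : Fin p × Fin v → Option ℕ} {r : ℕ}
    (hub : ∀ T', IsMatching d T' → T'.card ≤ r) {g : (GnrNM d r).ConnectedComponent}
    (hcard : Nat.card {i : Fin p // (GnrNM d r).connectedComponentMk (Sum.inl i) = g} =
      Nat.card {j : Fin v // (GnrNM d r).connectedComponentMk (Sum.inr j) = g})
    {i : Fin p} {j : Fin v} (hij : NonRedundantNM d r i j)
    (hi : (GnrNM d r).connectedComponentMk (Sum.inl i) = g) (hd : d (i, j) ≠ some 0) :
    Ideal.span {q : Polynomial (FractionRing (MvPolynomial ((Fin p × Fin v) × ℕ) ℝ)) |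
        ∃ (rsel : Fin r → Fin p) (csel : Fin r → Fin v),
          Function.Injective rsel ∧ Function.Injective csel ∧
          q = ((genericMatrix d).submatrix rsel csel).det} ≠ ⊤ := by
  classical
  obtain ⟨T, hT, hTr, hijT⟩ := hij
  have hM : MaxMatching d r T := ⟨hT, hTr, hub⟩
  obtain ⟨f, hf, hfT⟩ := hM.exists_row_map (g := g) fun a ha =>
    hM.exists_mem_of_card_eq hcard ha
  have hfs := ((Nat.bijective_iff_injective_and_card f).2 ⟨hf, hcard⟩).2
  let ι := algebraMap (MvPolynomial ((Fin p × Fin v) × ℕ) ℝ)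
    (FractionRing (MvPolynomial ((Fin p × Fin v) × ℕ) ℝ))
  let x : (Fin p × Fin v) × ℕ → Polynomial (MvPolynomial ((Fin p × Fin v) × ℕ) ℝ) :=
    fun q => Polynomial.C (MvPolynomial.X q)
  let δ := ((patternMatrix (nonRedundantPattern d r) x Polynomial.X).submatrix
    (Subtype.val : {i : Fin p // (GnrNM d r).connectedComponentMk (Sum.inl i) = g} → Fin p)
    (Subtype.val ∘ f)).det
  let m : Fin p × Fin v → ℕ := fun e => (d e).getD 0
  have hδ : δ.natDegree ≠ 0 := by
    let y : (Fin p × Fin v) × ℕ → ℝ := fun q => if q.1 ∈ T ∧ q.2 = m q.1 then 1 else 0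
    have h1 : Polynomial.mapRingHom (MvPolynomial.eval y) δ =
        ∏ a, Polynomial.X ^ m (a.1, (f a).1) := by
      have hy : (Polynomial.mapRingHom (MvPolynomial.eval y) ∘ x) =
          fun q => if q.1 ∈ T ∧ q.2 = m q.1 then 1 else 0 := by
        funext q
        by_cases h : q.1 ∈ T ∧ q.2 = m q.1 <;> simp [x, y, h]
      rw [map_det_patternMatrix, hy, ← Matrix.det_diagonal]
      congr 1
      ext1 a b
      rw [Matrix.submatrix_apply, patternMatrix_indicator, Matrix.diagonal_apply]
      · simp only [Function.comp_apply, Polynomial.coe_mapRingHom, Polynomial.map_X]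
        by_cases hab : a = b
        · subst hab
          rw [if_pos (hfT a), if_pos rfl]
        · rw [if_neg hab, if_neg]
          intro h
          exact hab (Subtype.ext (congrArg Prod.fst (hT.eq_of_snd h (hfT b) rfl)))
      · intro e he
        obtain ⟨k, hk⟩ := Option.ne_none_iff_exists'.1 (hT.1 e he)
        refine ⟨k, ?_, by simp [m, hk]⟩
        rw [← hk]
        exact nonRedundantPattern_of_nonRedundant (hM.nonRedundant he)
    have h2 : (∏ a, Polynomial.X ^ m (a.1, (f a).1) : Polynomial ℝ).natDegree ≤ δ.natDegree := by
      rw [← h1]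
      exact Polynomial.natDegree_map_le
    rw [Finset.prod_pow_eq_pow_sum, Polynomial.natDegree_X_pow] at h2
    have h3 : m (i, j) ≠ 0 := by
      obtain ⟨k, hk⟩ := Option.ne_none_iff_exists'.1 (hT.1 _ hijT)
      simp only [m, hk, Option.getD_some]
      rintro rfl
      exact hd hk
    have h4 := Finset.single_le_sum (f := fun a => m (a.1, (f a).1)) (fun _ _ => Nat.zero_le _)
      (Finset.mem_univ ⟨i, hi⟩)
    have h5 : ((i, (f ⟨i, hi⟩).1) : Fin p × Fin v) = (i, j) := hT.eq_of_fst (hfT ⟨i, hi⟩) hijT rfl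
    simp only [h5] at h4
    omega
  let κ := (algebraMap (FractionRing (MvPolynomial ((Fin p × Fin v) × ℕ) ℝ))
    (AlgebraicClosure (FractionRing (MvPolynomial ((Fin p × Fin v) × ℕ) ℝ))))
  obtain ⟨z, hz⟩ := IsAlgClosed.exists_eval₂_eq_zero_of_injective (κ.comp ι)
    (κ.injective.comp (IsFractionRing.injective _ _)) δ
    fun h => hδ (Polynomial.natDegree_eq_of_degree_eq_some h)
  have hblock := hz
  rw [← Polynomial.coe_eval₂RingHom, map_det_patternMatrix] at hblock
  intro htop
  have hle : Ideal.span {q : Polynomial (FractionRing (MvPolynomial ((Fin p × Fin v) × ℕ) ℝ)) |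
        ∃ (rsel : Fin r → Fin p) (csel : Fin r → Fin v),
          Function.Injective rsel ∧ Function.Injective csel ∧
          q = ((genericMatrix d).submatrix rsel csel).det} ≤
      RingHom.ker (Polynomial.eval₂RingHom κ z) := by
    rw [Ideal.span_le]
    rintro q ⟨rsel, csel, hr, hc, rfl⟩
    rw [SetLike.mem_coe, RingHom.mem_ker, genericMatrix_eq_patternMatrix, map_det_patternMatrix]
    have hx : (Polynomial.eval₂RingHom κ z ∘ fun q => Polynomial.C (ι (MvPolynomial.X q))) =
        Polynomial.eval₂RingHom (κ.comp ι) z ∘ x := by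
      funext q
      simp [x]
    have hX : Polynomial.eval₂RingHom κ z Polynomial.X =
        Polynomial.eval₂RingHom (κ.comp ι) z Polynomial.X := by
      simp
    rw [hx, hX]
    refine det_eq_zero_of_block_det_eq_zero hub _ _ hcard hfs hblock hr hc
  exact RingHom.ker_ne_top _ (top_le_iff.1 (htop ▸ hle))

/-- Non-minimal descriptions: if `r₁ ≥ 1` is the maximum size of a matching in
the support of `d`, then the `r₁ × r₁` minors of the generic matrix generate
the unit ideal of `K[s]` (structural controllability) if and only if for every
connected component of `G_nr` with as many row vertices as column vertices,
every non-redundant edge inside that component has degree zero. -/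
theorem generic_nonminimal_controllable_iff {p v : ℕ}
    (d : Fin p × Fin v → Option ℕ) (r₁ : ℕ) (hr₁ : 1 ≤ r₁)
    (hmax : IsGreatest {t : ℕ | ∃ T : Finset (Fin p × Fin v),
      IsMatching d T ∧ T.card = t} r₁) :
    Ideal.span {q : Polynomial (FractionRing (MvPolynomial ((Fin p × Fin v) × ℕ) ℝ)) |
        ∃ (rsel : Fin r₁ → Fin p) (csel : Fin r₁ → Fin v),
          Function.Injective rsel ∧ Function.Injective csel ∧
          q = ((genericMatrix d).submatrix rsel csel).det} = ⊤ ↔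
      ∀ g : (GnrNM d r₁).ConnectedComponent,
        Nat.card {i : Fin p // (GnrNM d r₁).connectedComponentMk (Sum.inl i) = g} =
          Nat.card {j : Fin v // (GnrNM d r₁).connectedComponentMk (Sum.inr j) = g} →
        ∀ (i : Fin p) (j : Fin v), NonRedundantNM d r₁ i j →
          (GnrNM d r₁).connectedComponentMk (Sum.inl i) = g →
          d (i, j) = some 0 := by
  obtain ⟨T, hT, hTr⟩ := hmax.1
  have hub : ∀ T', IsMatching d T' → T'.card ≤ r₁ := fun T' h => hmax.2 ⟨T', h, rfl⟩
  refine ⟨fun htop g hcard i j hij hi => ?_, fun H => ?_⟩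
  · by_contra hd
    exact span_minors_ne_top hub hcard hij hi hd htop
  · refine span_minors_eq_top ⟨hT, hTr, hub⟩ fun i j hij => ?_
    by_cases hcard : Nat.card {a : Fin p // (GnrNM d r₁).connectedComponentMk (Sum.inl a) =
        (GnrNM d r₁).connectedComponentMk (Sum.inl i)} =
      Nat.card {b : Fin v // (GnrNM d r₁).connectedComponentMk (Sum.inr b) =
        (GnrNM d r₁).connectedComponentMk (Sum.inl i)}
    · exact Or.inl (H _ hcard i j hij rfl)
    · exact Or.inr (hij.missable_of_card_ne hub rfl hcard)
end
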